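/- arXiv:2204.08281 — 2 statements merged into one kernel-verified Lean document; each statement's English description precedes it below -/
import Mathlib

section
/- Let F : ℝ^d → ℝ be twice continuously differentiable, α-strongly convex, and suppose the Hessian map x ↦ ∇²F(x) is H-Lipschitz in operator norm. Then for every δ > 0 the δ-ball smoothing F^δ satisfies ⟨∇F^δ(x) − ∇F^δ(x'), x − x'⟩ ≥ (α − Hδ)‖x − x'‖² for all x, x' ∈ ℝ^d; in particular, if δ ≤ cα/H for some c ∈ (0,1), then F^δ is (1−c)α-strongly convex. -/
open MeasureTheory Metric

/-- The uniform probability distribution on the closed unit ball of `ℝ^d`. -/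
noncomputable def uniformBall (d : ℕ) : Measure (EuclideanSpace ℝ (Fin d)) :=
  (volume (closedBall (0 : EuclideanSpace ℝ (Fin d)) 1))⁻¹ •
    volume.restrict (closedBall (0 : EuclideanSpace ℝ (Fin d)) 1)

/-- The `δ`-ball smoothing `F^δ(x) = E_{w∼𝔹}[F(x + δw)]`. -/
noncomputable def ballSmooth {d : ℕ} (F : EuclideanSpace ℝ (Fin d) → ℝ) (δ : ℝ)
    (x : EuclideanSpace ℝ (Fin d)) : ℝ :=
  ∫ w, F (x + δ • w) ∂(uniformBall d)

instance isProbabilityMeasure_uniformBall (d : ℕ) : IsProbabilityMeasure (uniformBall d) := by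
  constructor
  rw [uniformBall, Measure.smul_apply, Measure.restrict_apply_univ, smul_eq_mul]
  exact ENNReal.inv_mul_cancel (measure_closedBall_pos volume _ one_pos).ne'
    measure_closedBall_lt_top.ne

theorem ae_norm_le_one_uniformBall (d : ℕ) : ∀ᵐ w ∂(uniformBall d), ‖w‖ ≤ 1 := by
  refine Measure.ae_smul_measure ?_ _
  filter_upwards [ae_restrict_mem measurableSet_closedBall] with w hw
  simpa using hw

theorem Continuous.integrable_uniformBall {d : ℕ} {E : Type*} [NormedAddCommGroup E]
    {f : EuclideanSpace ℝ (Fin d) → E} (hf : Continuous f) : Integrable f (uniformBall d) :=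
  (hf.continuousOn.integrableOn_compact (isCompact_closedBall _ _)).smul_measure
    (ENNReal.inv_ne_top.2 (measure_closedBall_pos volume _ one_pos).ne')

theorem hasFDerivAt_ballSmooth {d : ℕ} {F : EuclideanSpace ℝ (Fin d) → ℝ}
    (hF : ContDiff ℝ 1 F) (δ : ℝ) (x : EuclideanSpace ℝ (Fin d)) :
    HasFDerivAt (ballSmooth F δ) (∫ w, fderiv ℝ F (x + δ • w) ∂(uniformBall d)) x := by
  have hc : Continuous F := hF.continuous
  have hc' : Continuous (fderiv ℝ F) := hF.continuous_fderiv one_ne_zero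
  obtain ⟨C, hC⟩ := (isCompact_closedBall x (1 + |δ|)).exists_bound_of_continuousOn
    hc'.continuousOn
  refine hasFDerivAt_integral_of_dominated_of_fderiv_le (bound := fun _ ↦ C)
    (F' := fun y w ↦ fderiv ℝ F (y + δ • w)) (ball_mem_nhds x one_pos)
    (.of_forall fun y ↦ ?_) ?_ ?_ ?_ (integrable_const _) (.of_forall fun w y _ ↦ ?_)
  · exact (show Continuous fun w ↦ F (y + δ • w) by fun_prop).integrable_uniformBall.1
  · exact (show Continuous fun w ↦ F (x + δ • w) by fun_prop).integrable_uniformBall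
  · exact (show Continuous fun w ↦ fderiv ℝ F (x + δ • w) by fun_prop).integrable_uniformBall.1
  · filter_upwards [ae_norm_le_one_uniformBall d] with w hw y hy
    refine hC _ ?_
    rw [mem_ball, dist_eq_norm] at hy
    rw [mem_closedBall, dist_eq_norm, add_sub_right_comm]
    refine (norm_add_le _ _).trans (add_le_add hy.le ?_)
    rw [norm_smul, Real.norm_eq_abs]
    exact mul_le_of_le_one_right (abs_nonneg _) hw
  · rw [hasFDerivAt_comp_add_right]
    exact (hF.differentiable one_ne_zero _).hasFDerivAt

open RealInnerProductSpace in
theorem inner_gradient_ballSmooth {d : ℕ} {F : EuclideanSpace ℝ (Fin d) → ℝ}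
    (hF : ContDiff ℝ 1 F) (δ : ℝ) (x v : EuclideanSpace ℝ (Fin d)) :
    ⟪gradient (ballSmooth F δ) x, v⟫ = ∫ w, ⟪gradient F (x + δ • w), v⟫ ∂(uniformBall d) := by
  have hc' : Continuous (fderiv ℝ F) := hF.continuous_fderiv one_ne_zero
  simp only [gradient, InnerProductSpace.toDual_symm_apply]
  rw [(hasFDerivAt_ballSmooth hF δ x).fderiv]
  exact ContinuousLinearMap.integral_apply
    (show Continuous fun w ↦ fderiv ℝ F (x + δ • w) by fun_prop).integrable_uniformBall v

open RealInnerProductSpace in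
/-- Ball smoothing preserves strong convexity, with the same constant. -/
theorem ballSmooth_strong_monotone_gradient {d : ℕ} {F : EuclideanSpace ℝ (Fin d) → ℝ}
    (hF : ContDiff ℝ 1 F) {α : ℝ}
    (hsc : ∀ x y, α * ‖x - y‖ ^ 2 ≤ ⟪gradient F x - gradient F y, x - y⟫)
    (δ : ℝ) (x y : EuclideanSpace ℝ (Fin d)) :
    α * ‖x - y‖ ^ 2
      ≤ ⟪gradient (ballSmooth F δ) x - gradient (ballSmooth F δ) y, x - y⟫ := by
  have hc' : Continuous (fderiv ℝ F) := hF.continuous_fderiv one_ne_zero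
  have hg : Continuous (gradient F) :=
    (InnerProductSpace.toDual ℝ (EuclideanSpace ℝ (Fin d))).symm.continuous.comp hc'
  have hint (z : EuclideanSpace ℝ (Fin d)) :
      Integrable (fun w ↦ ⟪gradient F (z + δ • w), x - y⟫) (uniformBall d) :=
    (show Continuous fun w ↦ ⟪gradient F (z + δ • w), x - y⟫ by fun_prop).integrable_uniformBall
  rw [inner_sub_left, inner_gradient_ballSmooth hF, inner_gradient_ballSmooth hF,
    ← integral_sub (hint x) (hint y)]
  calc α * ‖x - y‖ ^ 2 = ∫ _, α * ‖x - y‖ ^ 2 ∂(uniformBall d) := by simp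
    _ ≤ _ := integral_mono (integrable_const _) ((hint x).sub (hint y)) fun w ↦ by
      simpa [inner_sub_left] using hsc (x + δ • w) (y + δ • w)

open RealInnerProductSpace in
/-- If `F` is `C²`, `α`-strongly convex, with `H`-Lipschitz Hessian, then for
every `δ > 0` the smoothing `F^δ` satisfies
`⟨∇F^δ(x) − ∇F^δ(x'), x − x'⟩ ≥ (α − Hδ)‖x − x'‖²`; in particular, if `δ ≤ cα/H` with
`c ∈ (0,1)`, then `F^δ` is `(1−c)α`-strongly convex. -/
theorem stmt4 {d : ℕ} (F : EuclideanSpace ℝ (Fin d) → ℝ)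
    (hF : ContDiff ℝ 2 F) (α H : ℝ) (hα : 0 < α) (hH : 0 ≤ H)
    (hsc : ∀ x y, α * ‖x - y‖ ^ 2 ≤ ⟪gradient F x - gradient F y, x - y⟫)
    (hHess : ∀ x y, ‖fderiv ℝ (gradient F) x - fderiv ℝ (gradient F) y‖ ≤ H * ‖x - y‖)
    (δ : ℝ) (hδ : 0 < δ) :
    (∀ x x', (α - H * δ) * ‖x - x'‖ ^ 2
        ≤ ⟪gradient (ballSmooth F δ) x - gradient (ballSmooth F δ) x', x - x'⟫)
    ∧ (∀ c : ℝ, 0 < c → c < 1 → δ ≤ c * α / H →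
        ∀ x x', (1 - c) * α * ‖x - x'‖ ^ 2
          ≤ ⟪gradient (ballSmooth F δ) x - gradient (ballSmooth F δ) x', x - x'⟫) := by
  have key := ballSmooth_strong_monotone_gradient (hF.of_le one_le_two) hsc δ
  refine ⟨fun x x' ↦ le_trans ?_ (key x x'), fun c hc _ _ x x' ↦ le_trans ?_ (key x x')⟩
  · gcongr
    exact sub_le_self _ (mul_nonneg hH hδ.le)
  · gcongr
    exact mul_le_of_le_one_left hα.le (sub_le_self _ hc.le)
end

section
/- Let (D_t)_{t≥1} be a sequence of nonnegative real numbers, let t₀ ≥ 1 and a > 0 be constants, and suppose D_{t+1} ≤ (1 − 2/(t + t₀)) D_t + a/(t + t₀)² for all t ≥ 1. Then D_t ≤ max{(1 + t₀)D₁, a}/(t + t₀) for all t ≥ 1. -/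
/-- If `(D_t)_{t≥1}` is nonnegative, `t₀ ≥ 1`, `a > 0`, and
`D_{t+1} ≤ (1 − 2/(t + t₀)) D_t + a/(t + t₀)²` for all `t ≥ 1`, then
`D_t ≤ max{(1 + t₀)D₁, a}/(t + t₀)` for all `t ≥ 1`. -/
theorem stmt10 (D : ℕ → ℝ) (t₀ a : ℝ) (ht₀ : 1 ≤ t₀) (ha : 0 < a)
    (hD : ∀ t : ℕ, 1 ≤ t → 0 ≤ D t)
    (hrec : ∀ t : ℕ, 1 ≤ t →
      D (t + 1) ≤ (1 - 2 / ((t : ℝ) + t₀)) * D t + a / ((t : ℝ) + t₀) ^ 2) :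
    ∀ t : ℕ, 1 ≤ t → D t ≤ max ((1 + t₀) * D 1) a / ((t : ℝ) + t₀) := by
  set C := max ((1 + t₀) * D 1) a
  have haC : a ≤ C := le_max_right _ _
  intro t ht
  induction t, ht using Nat.le_induction with
  | base =>
    rw [le_div_iff₀ (by push_cast; linarith)]
    have h : (1 + t₀) * D 1 ≤ C := le_max_left _ _
    push_cast
    linarith
  | succ t ht ih =>
    have ht' : (1 : ℝ) ≤ t := by exact_mod_cast ht
    have hstep := hrec t ht
    have hcast : ((t + 1 : ℕ) : ℝ) + t₀ = (t + t₀) + 1 := by push_cast; ring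
    rw [hcast]
    have hs : 2 ≤ (t : ℝ) + t₀ := by linarith
    generalize (t : ℝ) + t₀ = s at *
    have hs0 : 0 < s := by linarith
    have hcoef : 0 ≤ 1 - 2 / s := by
      rw [sub_nonneg, div_le_one hs0]
      exact hs
    calc D (t + 1) ≤ (1 - 2 / s) * D t + a / s ^ 2 := hstep
      _ ≤ (1 - 2 / s) * (C / s) + C / s ^ 2 := by gcongr
      _ = C * (s - 1) / s ^ 2 := by field_simp; ring
      _ ≤ C / (s + 1) := by
        rw [div_le_div_iff₀ (by positivity) (by positivity)]
        linarith
end
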